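/- arXiv:2603.02107 — 2 statements merged into one kernel-verified Lean document; each statement's English description precedes it below -/
import Mathlib

section
/- Let c > 0 and m ∈ ℝ. A smooth function u : ℝ → ℝ satisfies the linear differential equation u''(x) + c·tanh(c·x+m)·u'(x) + c²·sech²(c·x+m)·u(x) = 0 for all x ∈ ℝ if and only if there exist constants d₁, d₂ ∈ ℝ such that u(x) = d₁·sech(c·x+m) + d₂·tanh(c·x+m) for all x ∈ ℝ, where sech(t) = 1/cosh(t). -/
lemma hasDerivAt_cosh_affine (c m x : ℝ) :
    HasDerivAt (fun x => Real.cosh (c * x + m)) (c * Real.sinh (c * x + m)) x := by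
  have h : HasDerivAt (fun x : ℝ => c * x + m) c x := by
    simpa using ((hasDerivAt_id x).const_mul c).add_const m
  simpa [mul_comm] using h.cosh

lemma hasDerivAt_sinh_affine (c m x : ℝ) :
    HasDerivAt (fun x => Real.sinh (c * x + m)) (c * Real.cosh (c * x + m)) x := by
  have h : HasDerivAt (fun x : ℝ => c * x + m) c x := by
    simpa using ((hasDerivAt_id x).const_mul c).add_const m
  simpa [mul_comm] using h.sinh

lemma hasDerivAt_sech_affine (c m x : ℝ) :
    HasDerivAt (fun x => (Real.cosh (c * x + m))⁻¹)
      (-c * (Real.cosh (c * x + m))⁻¹ * Real.tanh (c * x + m)) x := by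
  have hne := (Real.cosh_pos (c * x + m)).ne'
  refine ((hasDerivAt_cosh_affine c m x).fun_inv hne).congr_deriv ?_
  rw [Real.tanh_eq_sinh_div_cosh]
  field_simp

lemma hasDerivAt_tanh_affine (c m x : ℝ) :
    HasDerivAt (fun x => Real.tanh (c * x + m)) (c * ((Real.cosh (c * x + m))⁻¹) ^ 2) x := by
  have hne := (Real.cosh_pos (c * x + m)).ne'
  simp only [Real.tanh_eq_sinh_div_cosh]
  refine ((hasDerivAt_sinh_affine c m x).fun_div (hasDerivAt_cosh_affine c m x) hne).congr_deriv ?_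
  field_simp
  linear_combination c * Real.cosh_sq (c * x + m)

/-- `u'' + c·tanh(cx+m)·u' + c²·sech²(cx+m)·u = 0` on `ℝ` holds iff
`u = d₁·sech(cx+m) + d₂·tanh(cx+m)` for some constants `d₁, d₂`, where `sech = 1/cosh`. -/
theorem statement_9 (c m : ℝ) (hc : 0 < c) (u : ℝ → ℝ) (hu : ContDiff ℝ (⊤ : ℕ∞) u) :
    (∀ x : ℝ, deriv (deriv u) x + c * Real.tanh (c * x + m) * deriv u x
        + c ^ 2 * ((Real.cosh (c * x + m))⁻¹) ^ 2 * u x = 0) ↔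
    (∃ d₁ d₂ : ℝ, ∀ x : ℝ,
      u x = d₁ * (Real.cosh (c * x + m))⁻¹ + d₂ * Real.tanh (c * x + m)) := by
  constructor
  · intro h
    have hu₁ (x : ℝ) : HasDerivAt u (deriv u x) x :=
      (hu.differentiable (by simp) x).hasDerivAt
    have hu₂ (x : ℝ) : HasDerivAt (deriv u) (deriv (deriv u) x) x :=
      ((contDiff_infty_iff_deriv.1 hu).2.differentiable (by simp) x).hasDerivAt
    -- The equation is the derivative of `u' + c·tanh(cx+m)·u = a`.
    obtain ⟨a, ha⟩ : ∃ a, ∀ x, deriv u x + c * Real.tanh (c * x + m) * u x = a := by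
      have hd (x : ℝ) :
          HasDerivAt (fun x => deriv u x + c * Real.tanh (c * x + m) * u x) 0 x := by
        refine ((hu₂ x).fun_add
          (((hasDerivAt_tanh_affine c m x).const_mul c).fun_mul (hu₁ x))).congr_deriv ?_
        linear_combination h x
      exact ⟨_, fun x => is_const_of_deriv_eq_zero
        (fun x => (hd x).differentiableAt) (fun x => (hd x).deriv) x 0⟩
    -- Multiplying by the integrating factor `cosh(cx+m)` and integrating once more.
    obtain ⟨b, hb⟩ : ∃ b, ∀ x,
        Real.cosh (c * x + m) * u x - a / c * Real.sinh (c * x + m) = b := by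
      have hd (x : ℝ) : HasDerivAt
          (fun x => Real.cosh (c * x + m) * u x - a / c * Real.sinh (c * x + m)) 0 x := by
        refine (((hasDerivAt_cosh_affine c m x).fun_mul (hu₁ x)).fun_sub
          ((hasDerivAt_sinh_affine c m x).const_mul (a / c))).congr_deriv ?_
        have hne := (Real.cosh_pos (c * x + m)).ne'
        rw [← ha x, Real.tanh_eq_sinh_div_cosh]
        field_simp
        ring
      exact ⟨_, fun x => is_const_of_deriv_eq_zero
        (fun x => (hd x).differentiableAt) (fun x => (hd x).deriv) x 0⟩
    refine ⟨b, a / c, fun x => ?_⟩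
    have hne := (Real.cosh_pos (c * x + m)).ne'
    rw [← hb x, Real.tanh_eq_sinh_div_cosh]
    field_simp
    ring
  · rintro ⟨d₁, d₂, h⟩ x
    obtain rfl : u = _ := funext h
    have h₁ : deriv (fun x => d₁ * (Real.cosh (c * x + m))⁻¹ + d₂ * Real.tanh (c * x + m)) =
        fun x => d₁ * (-c * (Real.cosh (c * x + m))⁻¹ * Real.tanh (c * x + m)) +
          d₂ * (c * ((Real.cosh (c * x + m))⁻¹) ^ 2) :=
      funext fun x => (((hasDerivAt_sech_affine c m x).const_mul d₁).fun_add
        ((hasDerivAt_tanh_affine c m x).const_mul d₂)).deriv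
    have h₂ := (((((hasDerivAt_sech_affine c m x).const_mul (-c)).fun_mul
      (hasDerivAt_tanh_affine c m x)).const_mul d₁).fun_add
      ((((hasDerivAt_sech_affine c m x).fun_pow 2).const_mul c).const_mul d₂)).deriv
    rw [h₁, h₂]
    push_cast
    ring
end

section
/- Let R > 0 and m ∈ ℝ. A smooth function u : (m−R, m+R) → ℝ satisfies the linear differential equation (R² − (x−m)²)·u''(x) + (x−m)·u'(x) − u(x) = 0 for all x ∈ (m−R, m+R) if and only if there exist constants d₁, d₂ ∈ ℝ such that u(x) = d₁·(x−m) + d₂·(√(R² − (x−m)²) + (x−m)·arcsin((x−m)/R)) for all x ∈ (m−R, m+R). -/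
open Set in
/-- A function with zero derivative on an open interval is constant there. -/
lemma exists_eq_const_of_hasDerivAt_zero_Ioo {a b : ℝ} (hab : a < b) {f : ℝ → ℝ}
    (hf : ∀ x ∈ Ioo a b, HasDerivAt f 0 x) : ∃ c, ∀ x ∈ Ioo a b, f x = c := by
  obtain ⟨p, hp⟩ := nonempty_Ioo.2 hab
  refine ⟨f p, fun x hx => ?_⟩
  exact isOpen_Ioo.is_const_of_deriv_eq_zero isPreconnected_Ioo
    (fun y hy => (hf y hy).differentiableAt.differentiableWithinAt)
    (fun y hy => (hf y hy).deriv) hx hp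

lemma sq_sub_sq_pos_of_mem_Ioo {R m x : ℝ} (hx : x ∈ Set.Ioo (m - R) (m + R)) :
    0 < R ^ 2 - (x - m) ^ 2 := by
  nlinarith [mul_pos (sub_pos.2 hx.1) (sub_pos.2 hx.2)]

lemma hasDerivAt_sqrt_sq_sub_sq {R m x : ℝ} (hx : x ∈ Set.Ioo (m - R) (m + R)) :
    HasDerivAt (fun y => √(R ^ 2 - (y - m) ^ 2)) (-(x - m) / √(R ^ 2 - (x - m) ^ 2)) x := by
  have hpos := sq_sub_sq_pos_of_mem_Ioo hx
  have h : HasDerivAt (fun y : ℝ => R ^ 2 - (y - m) ^ 2) (-(2 * (x - m))) x := by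
    simpa using (((hasDerivAt_id x).sub_const m).pow 2).const_sub (R ^ 2)
  convert h.sqrt hpos.ne' using 1
  have := (Real.sqrt_pos.2 hpos).ne'
  field_simp

lemma hasDerivAt_arcsin_sub_div {R m x : ℝ} (hR : 0 < R) (hx : x ∈ Set.Ioo (m - R) (m + R)) :
    HasDerivAt (fun y => Real.arcsin ((y - m) / R)) (1 / √(R ^ 2 - (x - m) ^ 2)) x := by
  have h₁ : -1 < (x - m) / R := by rw [lt_div_iff₀ hR]; linarith [hx.1]
  have h₂ : (x - m) / R < 1 := by rw [div_lt_iff₀ hR]; linarith [hx.2]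
  have h : HasDerivAt (fun y : ℝ => (y - m) / R) (1 / R) x :=
    ((hasDerivAt_id x).sub_const m).div_const R
  have hs : √(R ^ 2 - (x - m) ^ 2) = R * √(1 - ((x - m) / R) ^ 2) := by
    rw [show R ^ 2 - (x - m) ^ 2 = R ^ 2 * (1 - ((x - m) / R) ^ 2) by field_simp,
      Real.sqrt_mul (sq_nonneg R), Real.sqrt_sq hR.le]
  refine ((Real.hasDerivAt_arcsin h₁.ne' h₂.ne).comp x h).congr_deriv ?_
  rw [hs, one_div_mul_one_div, mul_comm]

/-- `(R² − (x−m)²)·u'' + (x−m)·u' − u = 0` on `(m−R, m+R)` holds iff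
`u = d₁·(x−m) + d₂·(√(R² − (x−m)²) + (x−m)·arcsin((x−m)/R))` for some constants `d₁, d₂`. -/
theorem statement_10 (R m : ℝ) (hR : 0 < R) (u : ℝ → ℝ)
    (hu : ContDiffOn ℝ (⊤ : ℕ∞) u (Set.Ioo (m - R) (m + R))) :
    (∀ x ∈ Set.Ioo (m - R) (m + R),
      (R ^ 2 - (x - m) ^ 2) * deriv (deriv u) x + (x - m) * deriv u x - u x = 0) ↔
    (∃ d₁ d₂ : ℝ, ∀ x ∈ Set.Ioo (m - R) (m + R),
      u x = d₁ * (x - m)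
        + d₂ * (Real.sqrt (R ^ 2 - (x - m) ^ 2)
            + (x - m) * Real.arcsin ((x - m) / R))) := by
  have hlin (x : ℝ) : HasDerivAt (fun y : ℝ => y - m) 1 x := (hasDerivAt_id x).sub_const m
  constructor
  · intro hode
    have hu' : ∀ x ∈ Set.Ioo (m - R) (m + R), HasDerivAt u (deriv u x) x := fun x hx =>
      ((hu.differentiableOn (by simp)).differentiableAt (isOpen_Ioo.mem_nhds hx)).hasDerivAt
    have hu'' : ∀ x ∈ Set.Ioo (m - R) (m + R),
        HasDerivAt (deriv u) (deriv (deriv u) x) x := fun x hx =>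
      (((hu.deriv_of_isOpen (m := (⊤ : ℕ∞)) isOpen_Ioo (by simp)).differentiableOn
        (by simp)).differentiableAt (isOpen_Ioo.mem_nhds hx)).hasDerivAt
    have hab : m - R < m + R := by linarith
    obtain ⟨d₂, hd₂⟩ := exists_eq_const_of_hasDerivAt_zero_Ioo hab
      (f := fun x => (u x - (x - m) * deriv u x) / √(R ^ 2 - (x - m) ^ 2)) fun x hx => by
        have hpos := sq_sub_sq_pos_of_mem_Ioo hx
        have hs := (Real.sqrt_pos.2 hpos).ne'
        have hsq := Real.sq_sqrt hpos.le
        refine (((hu' x hx).sub ((hlin x).mul (hu'' x hx))).div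
          (hasDerivAt_sqrt_sq_sub_sq hx) hs).congr_deriv ?_
        have h := hode x hx
        rw [← hsq] at h
        simp only [Pi.sub_apply, Pi.mul_apply]
        generalize √(R ^ 2 - (x - m) ^ 2) = s at *
        field_simp
        linear_combination (-(x - m)) * h
    have hval : ∀ x ∈ Set.Ioo (m - R) (m + R),
        u x - (x - m) * deriv u x = d₂ * √(R ^ 2 - (x - m) ^ 2) := fun x hx =>
      (div_eq_iff (Real.sqrt_pos.2 (sq_sub_sq_pos_of_mem_Ioo hx)).ne').1 (hd₂ x hx)
    obtain ⟨d₁, hd₁⟩ := exists_eq_const_of_hasDerivAt_zero_Ioo hab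
      (f := fun x => deriv u x - d₂ * Real.arcsin ((x - m) / R)) fun x hx => by
        have hpos := sq_sub_sq_pos_of_mem_Ioo hx
        have hs := (Real.sqrt_pos.2 hpos).ne'
        have hsq := Real.sq_sqrt hpos.le
        refine ((hu'' x hx).sub
          ((hasDerivAt_arcsin_sub_div hR hx).const_mul d₂)).congr_deriv ?_
        have h := hode x hx
        have hv := hval x hx
        rw [← hsq] at h
        generalize √(R ^ 2 - (x - m) ^ 2) = s at *
        have : s * (s * deriv (deriv u) x - d₂) = 0 := by linear_combination h + hv
        have := (mul_eq_zero.1 this).resolve_left hs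
        field_simp
        linear_combination this
    refine ⟨d₁, d₂, fun x hx => ?_⟩
    linear_combination hval x hx + (x - m) * hd₁ x hx
  · rintro ⟨d₁, d₂, hsol⟩
    have hu' : ∀ x ∈ Set.Ioo (m - R) (m + R),
        deriv u x = d₁ + d₂ * Real.arcsin ((x - m) / R) := fun x hx => by
      have h := ((hlin x).const_mul d₁).add (((hasDerivAt_sqrt_sq_sub_sq hx).add
        ((hlin x).mul (hasDerivAt_arcsin_sub_div hR hx))).const_mul d₂)
      refine ((h.congr_of_eventuallyEq ?_).deriv).trans (by ring)
      filter_upwards [isOpen_Ioo.mem_nhds hx] with y hy using hsol y hy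
    intro x hx
    have hu'' : deriv (deriv u) x = d₂ * (1 / √(R ^ 2 - (x - m) ^ 2)) := by
      have h := ((hasDerivAt_arcsin_sub_div hR hx).const_mul d₂).const_add d₁
      refine (h.congr_of_eventuallyEq ?_).deriv
      filter_upwards [isOpen_Ioo.mem_nhds hx] with y hy using hu' y hy
    have hpos := sq_sub_sq_pos_of_mem_Ioo hx
    have hs := (Real.sqrt_pos.2 hpos).ne'
    have hsq := Real.sq_sqrt hpos.le
    rw [hu'', hu' x hx, hsol x hx]
    nth_rewrite 1 [← hsq]
    generalize √(R ^ 2 - (x - m) ^ 2) = s at *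
    field_simp
    ring
end
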